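/- There exists a self-dual binary linear code C ⊆ F₂^{72} whose minimum nonzero Hamming weight is 12, which contains exactly 942 codewords of Hamming weight 12 and exactly 8640 codewords of Hamming weight 14 (the weight enumerator W_{72,1} with γ = 0 and β = 471). -/

import Mathlib

/-- A subspace `C` of `(ZMod 2)^ι` is self-dual if it equals its Euclidean dual. -/
def IsSelfDual {R : Type*} [CommRing R] {ι : Type*} [Fintype ι]
    (C : Submodule R (ι → R)) : Prop :=
  ∀ x, x ∈ C ↔ ∀ y ∈ C, ∑ i, x i * y i = 0

/-- The Hamming weight of a vector: the number of nonzero coordinates. -/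
def hamWt {ι : Type*} [Fintype ι] {R : Type*} [Zero R] [DecidableEq R] (v : ι → R) : ℕ :=
  (Finset.univ.filter fun i => v i ≠ 0).card

/-- Evaluate `n` to a numeral before passing it to `f`; propositionally this is just `f n`. -/
def Nat.forceThen {α : Type*} (n : ℕ) (f : ℕ → α) : α :=
  match n with
  | 0 => f 0
  | Nat.succ m => f (Nat.succ m)

/-- Evaluate all entries of a list to numerals before passing the list to `f`. -/
def List.forceThen {α : Type*} : List ℕ → (List ℕ → α) → α
  | [], f => f []
  | x :: l, f => x.forceThen fun y => l.forceThen fun l' => f (y :: l')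

namespace BitSlice

/-- Evaluate all numbers of a list of bit-sliced tables before passing the list to `f`. -/
def forceTables {α : Type*} : List (ℕ × List ℕ) → (List (ℕ × List ℕ) → α) → α
  | [], f => f []
  | s :: t, f => s.1.forceThen fun a => s.2.forceThen fun b => forceTables t fun t' =>
      f ((a, b) :: t')

/-- Concatenate two bit-sliced tables, the first of which has `len` lanes. -/
def append (len : ℕ) (cs ds : List ℕ) : List ℕ :=
  List.zipWith (fun c d => c ||| d <<< len) cs ds

/-- Add the constant vector `r` to every lane of a bit-sliced table. -/
def translate (ones : ℕ) (r : List Bool) (cs : List ℕ) : List ℕ :=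
  List.zipWith (fun b c => bif b then c ^^^ ones else c) r cs

/-- Given bit-sliced tables of the sums of `k`, `k + 1`, … rows, include one more row `r` into the
tables for `k + 1`, …. -/
def insertRowAux (r : List Bool) : ℕ × List ℕ → List (ℕ × List ℕ) → List (ℕ × List ℕ)
  | _, [] => []
  | s, s' :: t =>
    (s'.1 + s.1, append s'.1 s'.2 (translate (2 ^ s.1 - 1) r s.2)) :: insertRowAux r s' t

/-- Given bit-sliced tables of the sums of `0`, `1`, … rows, include one more row `r`. -/
def insertRow (r : List Bool) : List (ℕ × List ℕ) → List (ℕ × List ℕ)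
  | [] => []
  | s :: t => s :: insertRowAux r s t

/-- The bit-sliced tables of the sums of `0`, `1`, …, `K` of the given rows of length `n`. -/
def withTables {α : Type*} (K n : ℕ) : List (List Bool) → (List (ℕ × List ℕ) → α) → α
  | [], f => f ((1, List.replicate n 0) :: List.replicate K (0, List.replicate n 0))
  | r :: rs, f => withTables K n rs fun t => forceTables (insertRow r t) f

/-- Add a bit to a bit-sliced binary counter, least significant digit first. -/
def addBit : List ℕ → ℕ → List ℕ
  | [], _ => []
  | c :: cs, b => (c ^^^ b) :: addBit cs (c &&& b)

/-- Add several bits to a bit-sliced binary counter. -/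
def withCounter {α : Type*} : List ℕ → List ℕ → (List ℕ → α) → α
  | cs, [], f => f cs
  | cs, b :: bs, f => (addBit cs b).forceThen fun cs' => withCounter cs' bs f

/-- The lanes of a bit-sliced counter whose value is `m`. -/
def eqMask (ones : ℕ) : List ℕ → ℕ → ℕ
  | [], _ => ones
  | c :: cs, m => (bif Nat.beq (m % 2) 1 then c else c ^^^ ones) &&& eqMask ones cs (m / 2)

/-- Add two bit-sliced binary counters and a carry. -/
def addCounters : List ℕ → List ℕ → ℕ → List ℕ
  | a :: as, b :: bs, c =>
    (a ^^^ b ^^^ c) :: addCounters as bs ((a &&& b) ||| ((a ^^^ b) &&& c))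
  | _, _, c => [c]

/-- The sum of the values in the `2 ^ d` lanes of a bit-sliced binary counter. -/
def sumLanes : ℕ → List ℕ → ℕ
  | 0, cs => cs.foldr (fun c s => c % 2 + 2 * s) 0
  | d + 1, cs =>
    (addCounters (cs.map (· &&& (2 ^ 2 ^ d - 1))) (cs.map (· >>> 2 ^ d)) 0).forceThen (sumLanes d)

/-- The number of lanes of a bit-sliced table of weight `l`, for each `l ≤ W`, assuming that it
has at most `2 ^ d` lanes. -/
def weightHistogram (d W : ℕ) (s : ℕ × List ℕ) : List ℕ :=
  withCounter (List.replicate 6 0) s.2 fun cs =>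
    (List.range (W + 1)).map fun l => sumLanes d [eqMask (2 ^ s.1 - 1) cs l]

/-- The weight histograms of a list of tables, where the bound on the weight decreases by one
from each table to the next. -/
def weightHistograms (d : ℕ) : ℕ → List (ℕ × List ℕ) → List (List ℕ)
  | _, [] => []
  | W, s :: t => weightHistogram d W s :: weightHistograms d (W - 1) t

/-- Numbers of sums of `k ≤ K` rows of weight `l ≤ W - k`. -/
def weightTable (d K W n : ℕ) (rows : List (List Bool)) : List (List ℕ) :=
  withTables K n rows (weightHistograms d W)

end BitSlice

@[simp]
theorem Nat.forceThen_eq {α : Type*} (n : ℕ) (f : ℕ → α) : n.forceThen f = f n := by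
  cases n <;> rfl

@[simp]
theorem List.forceThen_eq {α : Type*} (l : List ℕ) (f : List ℕ → α) : l.forceThen f = f l := by
  induction l generalizing f with
  | nil => rfl
  | cons x l ih => simp [List.forceThen, ih]

namespace BitSlice

@[simp]
theorem forceTables_eq {α : Type*} (t : List (ℕ × List ℕ)) (f : List (ℕ × List ℕ) → α) :
    forceTables t f = f t := by
  induction t generalizing f with
  | nil => rfl
  | cons s t ih => simp [forceTables, ih]

/-- The digits of `x` are the values of the predicate `p` along the list `L`. -/
def Slice {V : Type*} (L : List V) (x : ℕ) (p : V → Bool) : Prop :=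
  ∀ i, x.testBit i = (L[i]?).any p

section Slice

variable {V : Type*} {L M : List V} {x y : ℕ} {p q : V → Bool}

theorem Slice.congr (h : Slice L x p) (hpq : ∀ v, p v = q v) : Slice L x q := by
  rwa [← funext hpq]

theorem slice_ones (L : List V) : Slice L (2 ^ L.length - 1) fun _ => true := by
  intro i
  rw [Nat.testBit_two_pow_sub_one]
  by_cases h : i < L.length <;> simp [h]

theorem slice_zero (L : List V) : Slice L 0 fun _ => false := by
  intro i
  cases L[i]? <;> simp

theorem Slice.xor (hx : Slice L x p) (hy : Slice L y q) :
    Slice L (x ^^^ y) fun v => p v ^^ q v := by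
  intro i
  rw [Nat.testBit_xor, hx, hy]
  cases L[i]? <;> simp

theorem Slice.and (hx : Slice L x p) (hy : Slice L y q) :
    Slice L (x &&& y) fun v => p v && q v := by
  intro i
  rw [Nat.testBit_and, hx, hy]
  cases L[i]? <;> simp

theorem Slice.not (hx : Slice L x p) : Slice L (x ^^^ (2 ^ L.length - 1)) fun v => !p v :=
  (hx.xor (slice_ones L)).congr fun v => by simp

theorem Slice.append (hx : Slice L x p) (hy : Slice M y p) :
    Slice (L ++ M) (x ||| y <<< L.length) p := by
  intro i
  rw [Nat.testBit_or, Nat.testBit_shiftLeft, hx, hy, List.getElem?_append]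
  by_cases h : i < L.length
  · simp [h]
  · simp [h, Nat.le_of_not_lt h]

theorem Slice.map {W : Type*} {f : W → V} {L : List W} (h : Slice L x fun w => p (f w)) :
    Slice (L.map f) x p := by
  intro i
  rw [h, List.getElem?_map, Option.any_map]

end Slice

/-- The sums of `k` of the given vectors. -/
def subsetSums {V : Type*} [AddZeroClass V] : List V → ℕ → List V
  | _, 0 => [0]
  | [], _ + 1 => []
  | r :: rs, k + 1 => subsetSums rs (k + 1) ++ (subsetSums rs k).map (r + ·)

/-- `s` consists of the length of `L` and of the slices of `L` along the predicates `ps`. -/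
def IsTable {V : Type*} (ps : List (V → Bool)) (L : List V) (s : ℕ × List ℕ) : Prop :=
  s.1 = L.length ∧ List.Forall₂ (Slice L) s.2 ps

/-- `t` consists of tables of the sums of `k`, `k + 1`, … of the vectors `rs`. -/
def AreTables {V : Type*} [AddZeroClass V] (ps : List (V → Bool)) (rs : List V) :
    ℕ → List (ℕ × List ℕ) → Prop
  | _, [] => True
  | k, s :: t => IsTable ps (subsetSums rs k) s ∧ AreTables ps rs (k + 1) t

section Tables

variable {V : Type*} {ps : List (V → Bool)}

theorem IsTable.append {L M : List V} {s s' : ℕ × List ℕ} (hs : IsTable ps L s)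
    (hs' : IsTable ps M s') :
    IsTable ps (L ++ M) (s.1 + s'.1, BitSlice.append s.1 s.2 s'.2) := by
  obtain ⟨n, cs⟩ := s
  obtain ⟨n', ds⟩ := s'
  obtain ⟨rfl, h⟩ := hs
  obtain ⟨rfl, h'⟩ := hs'
  refine ⟨by simp, ?_⟩
  dsimp only at h h' ⊢
  induction h generalizing ds with
  | nil => cases h'; exact .nil
  | cons hx _ ih =>
    cases h' with
    | cons hy h' => exact .cons (hx.append hy) (ih _ h')

theorem IsTable.translate [Add V] (hps : ∀ p ∈ ps, ∀ a b : V, p (a + b) = (p a ^^ p b)) (r : V)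
    {L : List V} {s : ℕ × List ℕ} (hs : IsTable ps L s) :
    IsTable ps (L.map (r + ·))
      (s.1, BitSlice.translate (2 ^ s.1 - 1) (ps.map fun p => p r) s.2) := by
  obtain ⟨n, cs⟩ := s
  obtain ⟨rfl, h⟩ := hs
  refine ⟨by simp, ?_⟩
  dsimp only at h ⊢
  induction h with
  | nil => exact .nil
  | @cons c p cs ps hx _ ih =>
    refine .cons (Slice.map ?_) (ih fun p hp => hps p (List.mem_cons_of_mem _ hp))
    have hp := hps p List.mem_cons_self r
    cases hr : p r
    · simpa [hp, hr] using hx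
    · simpa [hp, hr] using hx.not

theorem AreTables.insertRow [AddZeroClass V]
    (hps : ∀ p ∈ ps, ∀ a b : V, p (a + b) = (p a ^^ p b)) (r : V) {rs : List V}
    {t : List (ℕ × List ℕ)} (ht : AreTables ps rs 0 t) :
    AreTables ps (r :: rs) 0 (BitSlice.insertRow (ps.map fun p => p r) t) := by
  have aux : ∀ (t : List (ℕ × List ℕ)) (k : ℕ) (s : ℕ × List ℕ),
      IsTable ps (subsetSums rs k) s → AreTables ps rs (k + 1) t →
      AreTables ps (r :: rs) (k + 1) (insertRowAux (ps.map fun p => p r) s t) := by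
    intro t
    induction t with
    | nil => intros; trivial
    | cons s' t ih =>
      intro k s hs ht
      exact ⟨ht.1.append (hs.translate hps r), ih _ _ ht.1 ht.2⟩
  cases t with
  | nil => trivial
  | cons s t =>
    have hs : subsetSums (r :: rs) 0 = subsetSums rs 0 := by simp [subsetSums]
    exact ⟨hs ▸ ht.1, aux t 0 s ht.1 ht.2⟩

theorem exists_withTables_eq [AddZeroClass V]
    (hps : ∀ p ∈ ps, ∀ a b : V, p (a + b) = (p a ^^ p b)) (hps₀ : ∀ p ∈ ps, p 0 = false)
    (K : ℕ) (rs : List V) :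
    ∃ t, AreTables ps rs 0 t ∧ ∀ {α : Type} (f : List (ℕ × List ℕ) → α),
      withTables K ps.length (rs.map fun r => ps.map fun p => p r) f = f t := by
  have zero (L : List V) (hL : ∀ v ∈ L, v = 0) :
      List.Forall₂ (Slice L) (List.replicate ps.length 0) ps := by
    clear hps
    induction ps with
    | nil => exact .nil
    | cons p ps ih =>
      refine .cons (fun i => ?_) (ih fun p hp => hps₀ p (List.mem_cons_of_mem _ hp))
      cases h : L[i]? with
      | none => simp
      | some v => simp [hL v (List.mem_of_getElem? h), hps₀ p List.mem_cons_self]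
  have empty (k : ℕ) :
      AreTables ps ([] : List V) (k + 1) (List.replicate K (0, List.replicate ps.length 0)) := by
    induction K generalizing k with
    | zero => trivial
    | succ K ih => exact ⟨⟨rfl, zero _ (by simp [subsetSums])⟩, ih _⟩
  induction rs with
  | nil => exact ⟨_ :: _, ⟨⟨rfl, zero _ (by simp [subsetSums])⟩, empty 0⟩, fun f => rfl⟩
  | cons r rs ih =>
    obtain ⟨t, ht, h⟩ := ih
    exact ⟨_, ht.insertRow hps r, fun f => by simp [withTables, h]⟩

theorem length_subsetSums [AddZeroClass V] (rs : List V) (k : ℕ) :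
    (subsetSums rs k).length = rs.length.choose k := by
  induction rs generalizing k with
  | nil => cases k <;> simp [subsetSums]
  | cons r rs ih => cases k <;> simp [subsetSums, ih, Nat.choose_succ_succ, add_comm]

end Tables

/-- The slices `cs` are the binary digits, least significant first, of the values of `f` along
`L`, reduced modulo `2 ^ cs.length`. -/
def IsCounter {V : Type*} (L : List V) : List ℕ → (V → ℕ) → Prop
  | [], _ => True
  | c :: cs, f => Slice L c (fun v => decide (f v % 2 = 1)) ∧ IsCounter L cs fun v => f v / 2

section Counter

variable {V : Type*} {L : List V}

theorem isCounter_zero (L : List V) (n : ℕ) : IsCounter L (List.replicate n 0) fun _ => 0 := by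
  induction n with
  | zero => trivial
  | succ n ih => exact ⟨slice_zero L, by simpa using ih⟩

@[simp]
theorem length_addBit (cs : List ℕ) (b : ℕ) : (addBit cs b).length = cs.length := by
  induction cs generalizing b with
  | nil => rfl
  | cons c cs ih => simp [addBit, ih]

theorem IsCounter.addBit {cs : List ℕ} {f : V → ℕ} (hf : IsCounter L cs f) {b : ℕ}
    {p : V → Bool} (hb : Slice L b p) :
    IsCounter L (addBit cs b) fun v => f v + (p v).toNat := by
  induction cs generalizing f b p with
  | nil => trivial
  | cons c cs ih =>
    refine ⟨(hf.1.xor hb).congr fun v => ?_, ?_⟩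
    · rcases Nat.mod_two_eq_zero_or_one (f v) with h | h <;> cases hp : p v <;>
        simp [Nat.add_mod, hp, h]
    · convert ih hf.2 (hf.1.and hb) using 2 with v
      cases hp : p v
      · simp [hp]
      · rcases Nat.mod_two_eq_zero_or_one (f v) with h | h <;> simp [hp, h] <;> omega

theorem exists_withCounter_eq {cs : List ℕ} {f : V → ℕ} (hf : IsCounter L cs f) {bs : List ℕ}
    {ps : List (V → Bool)} (hb : List.Forall₂ (Slice L) bs ps) :
    ∃ cs', cs'.length = cs.length ∧ IsCounter L cs' (fun v => f v + ps.countP fun p => p v) ∧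
      ∀ {α : Type} (g : List ℕ → α), withCounter cs bs g = g cs' := by
  induction hb generalizing cs f with
  | nil => exact ⟨cs, rfl, hf, fun g => rfl⟩
  | @cons b p bs ps hx _ ih =>
    obtain ⟨cs', hl, h, hg⟩ := ih (hf.addBit hx)
    refine ⟨cs', by simpa using hl, ?_, fun g => by simp [withCounter, hg]⟩
    convert h using 2 with v
    cases hp : p v <;> simp [hp]; omega

theorem IsCounter.slice_eqMask {cs : List ℕ} {f : V → ℕ} (hf : IsCounter L cs f) (m : ℕ) :
    Slice L (eqMask (2 ^ L.length - 1) cs m)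
      fun v => decide (f v % 2 ^ cs.length = m % 2 ^ cs.length) := by
  induction cs generalizing f m with
  | nil => exact (slice_ones L).congr fun v => by simp [Nat.mod_one]
  | cons c cs ih =>
    have digit : Slice L (bif Nat.beq (m % 2) 1 then c else c ^^^ (2 ^ L.length - 1))
        fun v => decide (f v % 2 = m % 2) := by
      rcases Nat.mod_two_eq_zero_or_one m with h | h
      · rw [h]
        exact hf.1.not.congr fun v => by
          rw [← decide_not]
          exact decide_eq_decide.2 Nat.mod_two_not_eq_one
      · simpa [h] using hf.1
    refine (digit.and (ih hf.2 (m / 2))).congr fun v => ?_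
    rw [← Bool.decide_and, List.length_cons, pow_succ', Nat.mod_mul, Nat.mod_mul]
    refine decide_eq_decide.2 ?_
    omega

end Counter

/-- The number of ones among the first `n` binary digits of `x`. -/
def onesBelow (n x : ℕ) : ℕ := ∑ i ∈ Finset.range n, (x.testBit i).toNat

/-- The sum of the values in the first `n` lanes of a bit-sliced binary counter. -/
def lanesTotal (n : ℕ) (cs : List ℕ) : ℕ := cs.foldr (fun c s => onesBelow n c + 2 * s) 0

theorem onesBelow_add (n a b c : ℕ) :
    onesBelow n (a ^^^ b ^^^ c) + 2 * onesBelow n ((a &&& b) ||| ((a ^^^ b) &&& c)) =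
      onesBelow n a + onesBelow n b + onesBelow n c := by
  simp only [onesBelow, Finset.mul_sum, ← Finset.sum_add_distrib]
  refine Finset.sum_congr rfl fun i _ => ?_
  simp only [Nat.testBit_xor, Nat.testBit_or, Nat.testBit_and]
  cases a.testBit i <;> cases b.testBit i <;> cases c.testBit i <;> rfl

theorem onesBelow_add_right (n x : ℕ) :
    onesBelow (n + n) x = onesBelow n (x &&& (2 ^ n - 1)) + onesBelow n (x >>> n) := by
  simp only [onesBelow, Finset.sum_range_add]
  congr 1
  · refine Finset.sum_congr rfl fun i hi => ?_
    simp [Finset.mem_range.1 hi]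
  · simp

theorem lanesTotal_addCounters (n : ℕ) {as bs : List ℕ} (h : as.length = bs.length) (c : ℕ) :
    lanesTotal n (addCounters as bs c) =
      lanesTotal n as + lanesTotal n bs + onesBelow n c := by
  induction as generalizing bs c with
  | nil =>
    cases bs with
    | nil => simp [addCounters, lanesTotal]
    | cons => simp at h
  | cons a as ih =>
    cases bs with
    | nil => simp at h
    | cons b bs =>
      have ih := ih (bs := bs) (by simpa using h) ((a &&& b) ||| ((a ^^^ b) &&& c))
      have := onesBelow_add n a b c
      simp only [lanesTotal, addCounters, List.foldr_cons] at ih ⊢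
      omega

theorem lanesTotal_add_right (n : ℕ) (cs : List ℕ) :
    lanesTotal (n + n) cs =
      lanesTotal n (cs.map (· &&& (2 ^ n - 1))) + lanesTotal n (cs.map (· >>> n)) := by
  induction cs with
  | nil => rfl
  | cons c cs ih =>
    simp only [lanesTotal, List.foldr_cons, List.map_cons, onesBelow_add_right] at ih ⊢
    omega

theorem sumLanes_eq (d : ℕ) (cs : List ℕ) : sumLanes d cs = lanesTotal (2 ^ d) cs := by
  induction d generalizing cs with
  | zero =>
    simp only [sumLanes, lanesTotal]
    congr! 4 with c
    rcases Nat.mod_two_eq_zero_or_one c with h | h <;> simp [onesBelow, h]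
  | succ d ih =>
    rw [sumLanes, List.forceThen_eq, ih, lanesTotal_addCounters _ (by simp), pow_succ, mul_two,
      lanesTotal_add_right]
    simp [onesBelow]

theorem Slice.onesBelow_eq {V : Type*} {L : List V} {x : ℕ} {p : V → Bool} (h : Slice L x p)
    {n : ℕ} (hn : L.length ≤ n) : onesBelow n x = L.countP p := by
  have key : ∀ n, L.length ≤ n →
      ∑ i ∈ Finset.range n, ((L[i]?).any p).toNat = L.countP p := by
    clear h hn
    induction L with
    | nil => simp
    | cons v L ih =>
      intro n hn
      obtain ⟨n, rfl⟩ : ∃ m, n = m + 1 := ⟨n - 1, by simp at hn; omega⟩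
      rw [Finset.sum_range_succ', List.countP_cons]
      simp only [List.getElem?_cons_succ, List.getElem?_cons_zero, Option.any_some]
      rw [ih n (by simpa using hn)]
      cases p v <;> simp
  rw [onesBelow, ← key n hn]
  exact Finset.sum_congr rfl fun i _ => by rw [h i]

theorem getElem?_weightHistogram {V : Type*} {ps : List (V → Bool)} {L : List V}
    {s : ℕ × List ℕ} (hs : IsTable ps L s) (hps : ps.length < 2 ^ 6) {d W l c : ℕ}
    (hd : L.length ≤ 2 ^ d) (hW : W < 2 ^ 6) (hc : (weightHistogram d W s)[l]? = some c) :
    L.countP (fun v => ps.countP (fun p => p v) = l) = c := by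
  obtain ⟨cs, hl, h, hg⟩ := exists_withCounter_eq (isCounter_zero L 6) hs.2
  rw [weightHistogram, hg, List.getElem?_map, Option.map_eq_some_iff] at hc
  obtain ⟨l', hl', rfl⟩ := hc
  obtain ⟨hlt, rfl⟩ := List.getElem?_eq_some_iff.1 hl'
  rw [List.length_range] at hlt
  rw [sumLanes_eq, List.getElem_range, hs.1]
  simp only [lanesTotal, List.foldr_cons, List.foldr_nil, mul_zero, add_zero]
  rw [(h.slice_eqMask l).onesBelow_eq hd, hl, List.length_replicate]
  congr! 3 with v
  have := ps.countP_le_length (p := fun p => p v)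
  rw [zero_add, Nat.mod_eq_of_lt (by omega), Nat.mod_eq_of_lt (by omega)]

theorem getElem?_weightHistograms {V : Type*} [AddZeroClass V] {ps : List (V → Bool)}
    {rs : List V} (hps : ps.length < 2 ^ 6) {d k l W c : ℕ} {j : ℕ} {t : List (ℕ × List ℕ)}
    {row : List ℕ} (ht : AreTables ps rs j t) (hd : rs.length.choose (j + k) ≤ 2 ^ d)
    (hW : W < 2 ^ 6) (hrow : (weightHistograms d W t)[k]? = some row) (hc : row[l]? = some c) :
    (subsetSums rs (j + k)).countP (fun v => ps.countP (fun p => p v) = l) = c := by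
  induction k generalizing j t W with
  | zero =>
    cases t with
    | nil => simp [weightHistograms] at hrow
    | cons s t =>
      obtain rfl : weightHistogram d W s = row := by simpa [weightHistograms] using hrow
      exact getElem?_weightHistogram ht.1 hps (by rwa [length_subsetSums]) hW hc
  | succ k ih =>
    cases t with
    | nil => simp [weightHistograms] at hrow
    | cons s t =>
      rw [← Nat.add_assoc, Nat.add_right_comm] at hd ⊢
      exact ih (W := W - 1) ht.2 hd (by omega) (by simpa [weightHistograms] using hrow)

end BitSlice

/-- The number of vectors `u` of weight `k` for which `u ᵥ* A` has weight `l`. -/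
def weightCount {m n : ℕ} (A : Matrix (Fin m) (Fin n) (ZMod 2)) (k l : ℕ) : ℕ :=
  (Finset.univ.filter fun u : Fin m → ZMod 2 =>
    hamWt u = k ∧ hamWt (Matrix.vecMul u A) = l).card

/-- The predicates `v j ≠ 0` on binary vectors `v`, for all coordinates `j`. -/
def nonzeroAt (n : ℕ) : List ((Fin n → ZMod 2) → Bool) :=
  (List.finRange n).map fun j v => decide (v j ≠ 0)

/-- The rows of a binary matrix as lists of Booleans. -/
def supportRows {m n : ℕ} (A : Matrix (Fin m) (Fin n) (ZMod 2)) : List (List Bool) :=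
  (List.ofFn A).map fun r => (nonzeroAt n).map fun p => p r

theorem hamWt_eq_sum {ι R : Type*} [Fintype ι] [Zero R] [DecidableEq R] (v : ι → R) :
    hamWt v = ∑ i, if v i ≠ 0 then 1 else 0 := by
  rw [hamWt, Finset.card_filter]

theorem hamWt_eq_zero {ι R : Type*} [Fintype ι] [Zero R] [DecidableEq R] {v : ι → R} :
    hamWt v = 0 ↔ v = 0 := by
  simp [hamWt, Finset.filter_eq_empty_iff, funext_iff]

theorem countP_nonzeroAt {n : ℕ} (v : Fin n → ZMod 2) :
    (nonzeroAt n).countP (fun p => p v) = hamWt v := by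
  rw [nonzeroAt, List.countP_map, List.countP_eq_length_filter]
  rfl

theorem card_filter_hamWt_eq_countP {m : ℕ} {V : Type*} [AddCommMonoid V] [Module (ZMod 2) V]
    (A : Fin m → V) (k : ℕ) (P : V → Bool) :
    (Finset.univ.filter fun u : Fin m → ZMod 2 => hamWt u = k ∧ P (∑ i, u i • A i)).card =
      (BitSlice.subsetSums (List.ofFn A) k).countP P := by
  induction m generalizing k P with
  | zero =>
    cases k <;> simp [BitSlice.subsetSums, hamWt, Finset.univ_unique]
    split_ifs <;> simp [*]
  | succ m ih =>
    have split (Q : (Fin (m + 1) → ZMod 2) → Prop) [DecidablePred Q] :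
        (Finset.univ.filter Q).card =
          (Finset.univ.filter fun u : Fin m → ZMod 2 => Q (Fin.cons 0 u)).card +
            (Finset.univ.filter fun u : Fin m → ZMod 2 => Q (Fin.cons 1 u)).card := by
      simp only [Finset.card_filter]
      rw [← (Fin.consEquiv fun _ => ZMod 2).sum_comp, Fintype.sum_prod_type]
      exact Fin.sum_univ_two _
    have wt (a : ZMod 2) (u : Fin m → ZMod 2) :
        hamWt (Fin.cons a u : Fin (m + 1) → ZMod 2) = (if a ≠ 0 then 1 else 0) + hamWt u := by
      simp [hamWt_eq_sum, Fin.sum_univ_succ]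
    rw [split]
    simp only [wt, Fin.sum_univ_succ, Fin.cons_zero, Fin.cons_succ, zero_smul, one_smul, zero_add,
      ne_eq, not_true_eq_false, if_false, one_ne_zero, not_false_eq_true, if_true]
    rw [ih (fun i => A i.succ) k P, List.ofFn_succ]
    cases k with
    | zero => cases m <;> simp [BitSlice.subsetSums]
    | succ k =>
      have := ih (fun i => A i.succ) k fun v => P (A 0 + v)
      simp only [BitSlice.subsetSums, List.countP_append, List.countP_map, add_comm 1,
        add_left_inj]
      rw [this]
      rfl

theorem weightCount_eq_of_weightTable_eq {m n d K W : ℕ} {A : Matrix (Fin m) (Fin n) (ZMod 2)}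
    {E : List (List ℕ)} (hE : BitSlice.weightTable d K W n (supportRows A) = E) (hn : n < 2 ^ 6)
    (hW : W < 2 ^ 6) {k l c : ℕ} (hd : m.choose k ≤ 2 ^ d)
    (hc : E[k]?.bind (·[l]?) = some c) : weightCount A k l = c := by
  have add : ∀ p ∈ nonzeroAt n, ∀ a b, p (a + b) = (p a ^^ p b) := by
    have h : ∀ x y : ZMod 2, decide (x + y ≠ 0) = (decide (x ≠ 0) ^^ decide (y ≠ 0)) := by decide
    simp only [nonzeroAt, List.mem_map]
    rintro _ ⟨j, -, rfl⟩ a b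
    exact h _ _
  have zero : ∀ p ∈ nonzeroAt n, p 0 = false := by
    simp [nonzeroAt]
  have len : (nonzeroAt n).length = n := by simp [nonzeroAt]
  obtain ⟨t, ht, h⟩ := BitSlice.exists_withTables_eq add zero K (List.ofFn A)
  obtain ⟨row, hrow, hcell⟩ := Option.bind_eq_some_iff.1 hc
  simp only [len] at h
  obtain rfl := (h _).symm.trans hE
  have := BitSlice.getElem?_weightHistograms (by rwa [len]) ht (k := k)
    (le_of_eq_of_le (congrArg₂ Nat.choose List.length_ofFn (Nat.zero_add k)) hd) hW hrow hcell
  rw [zero_add] at this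
  simp only [countP_nonzeroAt] at this
  rw [weightCount, ← this]
  refine Eq.trans ?_ (card_filter_hamWt_eq_countP A k _)
  simp [Matrix.vecMul_eq_sum]

theorem weightCount_transpose {n : ℕ} {A : Matrix (Fin n) (Fin n) (ZMod 2)}
    (hA : A * A.transpose = 1) (k l : ℕ) : weightCount A.transpose l k = weightCount A k l := by
  have hA' : A.transpose * A = 1 := mul_eq_one_comm.1 hA
  refine Finset.card_nbij' (Matrix.vecMul · A.transpose) (Matrix.vecMul · A) ?_ ?_ ?_ ?_
  · intro u hu
    simpa [hA', and_comm] using hu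
  · intro u hu
    simpa [hA, and_comm] using hu
  · intro u _
    simp [hA']
  · intro u _
    simp [hA]

/-- The binary linear code of length `n + n` with generator matrix `[I | A]`. -/
def systematicCode {n : ℕ} (A : Matrix (Fin n) (Fin n) (ZMod 2)) :
    Submodule (ZMod 2) (Fin (n + n) → ZMod 2) where
  carrier := {x | (fun j => x (Fin.natAdd n j)) = Matrix.vecMul (fun i => x (Fin.castAdd n i)) A}
  add_mem' {x y} hx hy := by
    simp only [Set.mem_ofPred_eq] at hx hy ⊢
    exact (congrArg₂ (· + ·) hx hy).trans (Matrix.add_vecMul A _ _).symm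
  zero_mem' := (Matrix.zero_vecMul A).symm
  smul_mem' c x hx := by
    simp only [Set.mem_ofPred_eq] at hx ⊢
    exact (congrArg (c • ·) hx).trans (Matrix.smul_vecMul c _ A).symm

section SystematicCode

variable {n : ℕ} {A : Matrix (Fin n) (Fin n) (ZMod 2)}

theorem append_mem_systematicCode {u w : Fin n → ZMod 2} :
    Fin.append u w ∈ systematicCode A ↔ w = Matrix.vecMul u A := by
  change ((fun j => Fin.append u w (Fin.natAdd n j)) =
    Matrix.vecMul (fun i => Fin.append u w (Fin.castAdd n i)) A) ↔ _
  simp only [Fin.append_left, Fin.append_right]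

theorem exists_eq_append (x : Fin (n + n) → ZMod 2) :
    ∃ u w, x = Fin.append u w :=
  ⟨_, _, (Fin.append_castAdd_natAdd (f := x)).symm⟩

theorem isSelfDual_systematicCode (hA : A * A.transpose = 1) : IsSelfDual (systematicCode A) := by
  have hA' : A.transpose * A = 1 := mul_eq_one_comm.1 hA
  have inner (u w u' w' : Fin n → ZMod 2) :
      ∑ i, Fin.append u w i * Fin.append u' w' i = u ⬝ᵥ u' + w ⬝ᵥ w' := by
    simp only [Fin.sum_univ_add, Fin.append_left, Fin.append_right, dotProduct]
  have expand (u w u' : Fin n → ZMod 2) :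
      u ⬝ᵥ u' + w ⬝ᵥ Matrix.vecMul u' A = (u + Matrix.vecMul w A.transpose) ⬝ᵥ u' := by
    rw [add_dotProduct, Matrix.vecMul_transpose, dotProduct_comm (Matrix.mulVec A w),
      Matrix.dotProduct_mulVec, dotProduct_comm w]
  intro x
  obtain ⟨u, w, rfl⟩ := exists_eq_append x
  have dual : (∀ y ∈ systematicCode A, ∑ i, Fin.append u w i * y i = 0) ↔
      u + Matrix.vecMul w A.transpose = 0 := by
    rw [← dotProduct_eq_zero_iff]
    constructor
    · intro h u'
      rw [← expand, ← inner]
      exact h _ (append_mem_systematicCode.2 rfl)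
    · intro h y hy
      obtain ⟨u', w', rfl⟩ := exists_eq_append y
      obtain rfl := append_mem_systematicCode.1 hy
      rw [inner, expand, h]
  have eq : u + Matrix.vecMul w A.transpose = 0 ↔ u = Matrix.vecMul w A.transpose := by
    simp only [funext_iff, Pi.add_apply, Pi.zero_apply, CharTwo.add_eq_zero]
  rw [dual, eq, append_mem_systematicCode]
  constructor
  · rintro rfl
    simp [hA]
  · rintro rfl
    simp [hA']

theorem hamWt_append (u w : Fin n → ZMod 2) : hamWt (Fin.append u w) = hamWt u + hamWt w := by
  simp only [hamWt_eq_sum, Fin.sum_univ_add, Fin.append_left, Fin.append_right]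

theorem card_systematicCode_hamWt_eq (A : Matrix (Fin n) (Fin n) (ZMod 2)) (w : ℕ) :
    Nat.card {v : Fin (n + n) → ZMod 2 // v ∈ systematicCode A ∧ hamWt v = w} =
      ∑ k ∈ Finset.range (w + 1), weightCount A k (w - k) := by
  have e : {v : Fin (n + n) → ZMod 2 // v ∈ systematicCode A ∧ hamWt v = w} ≃
      {u : Fin n → ZMod 2 // hamWt u + hamWt (Matrix.vecMul u A) = w} :=
    { toFun v := ⟨fun i => v.1 (Fin.castAdd n i), by
        obtain ⟨x, hx, rfl⟩ := v
        obtain ⟨u, w, rfl⟩ := exists_eq_append x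
        obtain rfl := append_mem_systematicCode.1 hx
        simp [hamWt_append]⟩
      invFun u := ⟨Fin.append u.1 (Matrix.vecMul u.1 A), append_mem_systematicCode.2 rfl, by
        rw [hamWt_append, u.2]⟩
      left_inv v := by
        obtain ⟨x, hx, rfl⟩ := v
        obtain ⟨u, w, rfl⟩ := exists_eq_append x
        obtain rfl := append_mem_systematicCode.1 hx
        simp
      right_inv u := by simp }
  rw [Nat.card_congr e, Nat.card_eq_fintype_card, Fintype.card_subtype,
    Finset.card_eq_sum_card_fiberwise (f := hamWt) (t := Finset.range (w + 1))]
  · refine Finset.sum_congr rfl fun k hk => ?_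
    rw [weightCount, Finset.filter_filter]
    congr 1
    ext u
    simp only [Finset.mem_filter, Finset.mem_univ, true_and, Finset.mem_range] at hk ⊢
    omega
  · intro u hu
    simp only [Finset.coe_filter, Finset.mem_univ, true_and, Set.mem_ofPred_eq] at hu
    simp only [Finset.coe_range, Set.mem_Iio]
    omega

end SystematicCode

/-- The rows, as binary numbers, of the redundancy part of a generator matrix. -/
def redundancyRows : List ℕ :=
  [1842513391, 31461301267, 49394773971, 6249939477, 13772125593, 68579874841, 54844413633,
    23677250521, 49169182913, 24310477617, 40075238319, 27462465713, 62813483055, 23041949105,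
    6756654933, 50257311635, 35549880597, 62218008322, 16596283656, 57061174984, 49378457040,
    64261135166, 2081161982, 11700374624, 64305950270, 17142866912, 22807247236, 63499578050,
    43948399684, 47735589456, 21523174016, 34489801472, 2864755264, 67330953728, 8637814272,
    68718952448]

/-- The matrix `A` for which `[I | A]` generates the code. -/
def redundancyMatrix : Matrix (Fin 36) (Fin 36) (ZMod 2) :=
  fun i j => bif (redundancyRows.getD i 0).testBit j then 1 else 0

theorem redundancyMatrix_mul_transpose : redundancyMatrix * redundancyMatrix.transpose = 1 := by
  decide +kernel

/-- The weight distribution of the sums of at most seven rows of `redundancyMatrix`. -/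
def rowSumWeights : List (List ℕ) :=
  [[1, 0, 0, 0, 0, 0, 0, 0, 0, 0, 0, 0, 0, 0, 0], [0, 0, 0, 0, 0, 0, 0, 0, 0, 0, 0, 4, 0, 2],
    [0, 0, 0, 0, 0, 0, 0, 0, 0, 0, 10, 0, 20], [0, 0, 0, 0, 0, 0, 0, 0, 0, 38, 0, 126],
    [0, 0, 0, 0, 0, 0, 0, 0, 106, 0, 497], [0, 0, 0, 0, 0, 0, 0, 180, 0, 1076],
    [0, 0, 0, 0, 0, 0, 263, 0, 1663], [0, 0, 0, 0, 0, 188, 0, 1855]]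

/-- The weight distribution of the sums of at most six columns of `redundancyMatrix`. -/
def columnSumWeights : List (List ℕ) :=
  [[1, 0, 0, 0, 0, 0, 0, 0, 0, 0, 0, 0, 0, 0, 0], [0, 0, 0, 0, 0, 0, 0, 0, 0, 0, 0, 4, 0, 0],
    [0, 0, 0, 0, 0, 0, 0, 0, 0, 0, 13, 0, 16], [0, 0, 0, 0, 0, 0, 0, 0, 0, 34, 0, 133],
    [0, 0, 0, 0, 0, 0, 0, 0, 102, 0, 469], [0, 0, 0, 0, 0, 0, 0, 188, 0, 1120],
    [0, 0, 0, 0, 0, 0, 263, 0, 1663]]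

theorem weightTable_redundancyMatrix :
    BitSlice.weightTable 23 7 14 36 (supportRows redundancyMatrix) = rowSumWeights := by
  decide +kernel

theorem weightTable_redundancyMatrix_transpose :
    BitSlice.weightTable 23 6 14 36 (supportRows redundancyMatrix.transpose) =
      columnSumWeights := by
  decide +kernel

theorem weightCount_redundancyMatrix_eq_rowSumWeights {k l : ℕ} (hk : k ≤ 7) (hl : k + l ≤ 14) :
    weightCount redundancyMatrix k l = (rowSumWeights.getD k []).getD l 0 := by
  have table : ∀ k ≤ 7, Nat.choose 36 k ≤ 2 ^ 23 ∧ ∀ l ≤ 14 - k,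
      rowSumWeights[k]?.bind (·[l]?) = some ((rowSumWeights.getD k []).getD l 0) := by
    decide
  exact weightCount_eq_of_weightTable_eq weightTable_redundancyMatrix (by norm_num) (by norm_num)
    (table k hk).1 ((table k hk).2 l (by omega))

theorem weightCount_redundancyMatrix_eq_columnSumWeights {k l : ℕ} (hl : l ≤ 6) (hk : k + l ≤ 14) :
    weightCount redundancyMatrix k l = (columnSumWeights.getD l []).getD k 0 := by
  have table : ∀ l ≤ 6, Nat.choose 36 l ≤ 2 ^ 23 ∧ ∀ k ≤ 14 - l,
      columnSumWeights[l]?.bind (·[k]?) = some ((columnSumWeights.getD l []).getD k 0) := by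
    decide
  rw [← weightCount_transpose redundancyMatrix_mul_transpose]
  exact weightCount_eq_of_weightTable_eq weightTable_redundancyMatrix_transpose (by norm_num)
    (by norm_num) (table l hl).1 ((table l hl).2 k (by omega))

/-- The numbers of codewords whose weight, at most `14`, is split as `k + l` over the two halves
of the coordinates. -/
theorem sum_weightCount_redundancyMatrix {w : ℕ} (hw : w ≤ 14) :
    ∑ k ∈ Finset.range (w + 1), weightCount redundancyMatrix k (w - k) =
      ∑ k ∈ Finset.range (w + 1), if k ≤ 7 then (rowSumWeights.getD k []).getD (w - k) 0
        else (columnSumWeights.getD (w - k) []).getD k 0 := by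
  refine Finset.sum_congr rfl fun k hk => ?_
  have := Finset.mem_range.1 hk
  split_ifs with h
  · exact weightCount_redundancyMatrix_eq_rowSumWeights h (by omega)
  · exact weightCount_redundancyMatrix_eq_columnSumWeights (by omega) (by omega)

theorem card_systematicCode_redundancyMatrix {w : ℕ} (hw : w ≤ 14) :
    Nat.card {v : Fin 72 → ZMod 2 // v ∈ systematicCode redundancyMatrix ∧ hamWt v = w} =
      [1, 0, 0, 0, 0, 0, 0, 0, 0, 0, 0, 0, 942, 0, 8640].getD w 0 := by
  have table : ∀ w ≤ 14,
      (∑ k ∈ Finset.range (w + 1), if k ≤ 7 then (rowSumWeights.getD k []).getD (w - k) 0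
        else (columnSumWeights.getD (w - k) []).getD k 0) =
      [1, 0, 0, 0, 0, 0, 0, 0, 0, 0, 0, 0, 942, 0, 8640].getD w 0 := by
    decide +kernel
  rw [← table w hw, ← sum_weightCount_redundancyMatrix hw]
  exact card_systematicCode_hamWt_eq redundancyMatrix w

/-- There is a self-dual binary linear code of length 72 with minimum nonzero Hamming
weight 12, having exactly 942 codewords of weight 12 and exactly 8640 codewords of
weight 14 (weight enumerator `W_{72,1}` with γ = 0 and β = 471). -/
theorem exists_selfDual_code_72_gamma_0_beta_471 :
    ∃ C : Submodule (ZMod 2) (Fin 72 → ZMod 2),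
      IsSelfDual C ∧
      IsLeast {k | ∃ v ∈ C, v ≠ 0 ∧ hamWt v = k} 12 ∧
      Nat.card {v : Fin 72 → ZMod 2 // v ∈ C ∧ hamWt v = 12} = 942 ∧
      Nat.card {v : Fin 72 → ZMod 2 // v ∈ C ∧ hamWt v = 14} = 8640 := by
  have card12 := card_systematicCode_redundancyMatrix (w := 12) (by norm_num)
  refine ⟨systematicCode redundancyMatrix,
    isSelfDual_systematicCode redundancyMatrix_mul_transpose, ⟨?_, ?_⟩, card12,
    card_systematicCode_redundancyMatrix (w := 14) le_rfl⟩
  · obtain ⟨⟨v, hv, hwt⟩⟩ := (Nat.card_pos_iff.1 (Nat.lt_of_lt_of_eq (by decide) card12.symm)).1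
    exact ⟨v, hv, fun h => by simp [hamWt_eq_zero.2 h] at hwt, hwt⟩
  · rintro k ⟨v, hv, hv0, hk⟩
    by_contra! hlt
    have hpos : k ≠ 0 := fun h => hv0 (hamWt_eq_zero.1 (hk.trans h))
    have hcard := card_systematicCode_redundancyMatrix (w := k) (by omega)
    have hzero : [1, 0, 0, 0, 0, 0, 0, 0, 0, 0, 0, 0, 942, 0, 8640].getD k 0 = 0 := by
      interval_cases k <;> first | rfl | contradiction
    rw [hzero, Nat.card_eq_zero] at hcard
    rcases hcard with h | h
    · exact h.elim ⟨v, hv, hk⟩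
    · exact not_finite_iff_infinite.2 h inferInstance
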